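/- arXiv:1407.6542 — 8 statements merged into one kernel-verified Lean document; each statement's English description precedes it below -/
import Mathlib

section
/- Let d ≥ 1, let V : ℝ^d → ℝ be strictly convex on all of ℝ^d, let v ∈ ℤ^d, and let σ be a finite-support permutation of ℤ^d different from the identity. Then Σ_{x ∈ supp σ} [V(σ(x) + v − x) − V(v)] > 0, where lattice points are viewed as points of ℝ^d. (In particular, every shift permutation τ_v(x) = x + v is a ground state: every local perturbation of τ_v strictly increases the energy.) -/
/-- Shift permutations are ground states: for a strictly convex potential `V` on `ℝ^d`,
any finite-support permutation `σ ≠ 1` of `ℤ^d` satisfies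
`∑_{x ∈ supp σ} [V(σ(x) + v − x) − V(v)] > 0`. -/
theorem shift_is_ground_state (d : ℕ) (hd : 1 ≤ d)
    (V : (Fin d → ℝ) → ℝ) (hV : StrictConvexOn ℝ Set.univ V)
    (v : Fin d → ℤ) (σ : Equiv.Perm (Fin d → ℤ))
    (hfin : {x | σ x ≠ x}.Finite) (hσ : σ ≠ 1) :
    0 < ∑ x ∈ hfin.toFinset,
      (V (fun i => (((σ x + v - x) i : ℤ) : ℝ)) - V (fun i => ((v i : ℤ) : ℝ))) := by
  classical
  set S := hfin.toFinset with hS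
  have hmemS : ∀ x, x ∈ S ↔ σ x ≠ x := by intro x; simp [hS]
  have hne : ∃ x, σ x ≠ x := by
    by_contra! h
    exact hσ (Equiv.ext h)
  obtain ⟨x₀, hx₀⟩ := hne
  have hx₀S := (hmemS x₀).2 hx₀
  have hcard : (0 : ℝ) < S.card := by
    exact_mod_cast Finset.card_pos.2 ⟨x₀, hx₀S⟩
  set p : (Fin d → ℤ) → (Fin d → ℝ) := fun x i => (((σ x + v - x) i : ℤ) : ℝ) with hp
  have h₁ : ∑ _x ∈ S, (S.card : ℝ)⁻¹ = 1 := by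
    rw [Finset.sum_const, nsmul_eq_mul, mul_inv_cancel₀ hcard.ne']
  have hmean : ∑ x ∈ S, (S.card : ℝ)⁻¹ • p x = fun i => ((v i : ℤ) : ℝ) := by
    rw [← Finset.smul_sum]
    funext i
    have hs : ∑ x ∈ S, ((σ x i : ℤ) : ℝ) = ∑ x ∈ S, ((x i : ℤ) : ℝ) :=
      Equiv.Perm.sum_comp σ S (fun x => ((x i : ℤ) : ℝ)) (by
        intro x hx
        exact (hmemS x).2 hx)
    have : ∑ x ∈ S, p x i = S.card * (v i : ℝ) := by
      simp only [hp, Pi.sub_apply, Pi.add_apply, Int.cast_sub, Int.cast_add,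
        Finset.sum_sub_distrib, Finset.sum_add_distrib, hs, Finset.sum_const, nsmul_eq_mul]
      ring
    rw [Pi.smul_apply, Finset.sum_apply, this, smul_eq_mul, inv_mul_cancel_left₀ hcard.ne']
  have key := (hV.map_sum_lt_iff_of_pos' (t := S) (w := fun _ => (S.card : ℝ)⁻¹) (p := p)
    (fun _ _ => inv_pos.2 hcard) h₁ (fun _ _ => Set.mem_univ _)).2 (by
      refine ⟨x₀, hx₀S, ?_⟩
      rw [hmean]
      intro h
      apply hx₀
      funext i
      have := congrFun h i
      simp only [hp, Int.cast_inj, Pi.sub_apply, Pi.add_apply] at this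
      linarith)
  rw [hmean, ← Finset.smul_sum, smul_eq_mul, lt_inv_mul_iff₀ hcard] at key
  rw [Finset.sum_sub_distrib, Finset.sum_const, nsmul_eq_mul]
  exact sub_pos.2 key
end

section
/- Let d ≥ 1, V : ℤ^d → ℝ, α > 0, and let Γ be the set of finite cycles of ℤ^d. Define m : Γ × Γ → [0,∞] by m(γ,θ) := w(θ) if supp γ ∩ supp θ ≠ ∅ and m(γ,θ) := 0 otherwise, and define matrix powers by m^1 := m and m^{n+1}(γ,θ) := Σ_{γ' ∈ Γ} m(γ,γ')·m^n(γ',θ) (sums in [0,∞]). Then for every finite cycle γ and every n ≥ 1: Σ_{θ ∈ Γ} m^n(γ,θ) ≤ |γ| · β(V,α)^n. Consequently, if β(V,α) < 1 then Σ_{n ≥ 1} Σ_{θ ∈ Γ} m^n(γ,θ) ≤ |γ| · β(V,α)/(1 − β(V,α)), which is finite. -/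
open scoped ENNReal

/-- The support of a permutation of `ℤ^d`. -/
def psupp {d : ℕ} (σ : Equiv.Perm (Fin d → ℤ)) : Set (Fin d → ℤ) := {x | σ x ≠ x}

/-- A finite cycle of `ℤ^d`: a cycle with finite support. -/
def IsFiniteCycle {d : ℕ} (θ : Equiv.Perm (Fin d → ℤ)) : Prop :=
  θ.IsCycle ∧ (psupp θ).Finite

/-- The set `Γ` of finite cycles of `ℤ^d`, as a subtype. -/
abbrev Cyc (d : ℕ) := {θ : Equiv.Perm (Fin d → ℤ) // IsFiniteCycle θ}

/-- The weight `w(θ) = exp(−α ∑_{x ∈ supp θ} V(θ(x) − x))` of a finite cycle. -/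
noncomputable def w {d : ℕ} (V : (Fin d → ℤ) → ℝ) (α : ℝ)
    (θ : Equiv.Perm (Fin d → ℤ)) : ℝ :=
  Real.exp (-α * ∑ᶠ x ∈ psupp θ, V (θ x - x))

/-- `β(V,α) = ∑_{θ finite cycle, 0 ∈ supp θ} |θ| w(θ)`, summed in `[0,∞]`. -/
noncomputable def beta {d : ℕ} (V : (Fin d → ℤ) → ℝ) (α : ℝ) : ℝ≥0∞ :=
  ∑' θ : {θ : Equiv.Perm (Fin d → ℤ) // IsFiniteCycle θ ∧ (0 : Fin d → ℤ) ∈ psupp θ},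
    ((psupp θ.1).ncard : ℝ≥0∞) * ENNReal.ofReal (w V α θ.1)

open Classical in
/-- The mean matrix `m(γ,θ) = w(θ) 1{supp γ ∩ supp θ ≠ ∅}` of the branching process. -/
noncomputable def mker {d : ℕ} (V : (Fin d → ℤ) → ℝ) (α : ℝ)
    (γ θ : Cyc d) : ℝ≥0∞ :=
  if (psupp γ.1 ∩ psupp θ.1).Nonempty then ENNReal.ofReal (w V α θ.1) else 0

open Classical in
/-- Matrix powers of `m`: `mpow V α 0` is the identity, `mpow V α 1 = m`, and
`m^{n+1}(γ,θ) = ∑_{γ'} m(γ,γ') m^n(γ',θ)` with sums in `[0,∞]`. -/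
noncomputable def mpow {d : ℕ} (V : (Fin d → ℤ) → ℝ) (α : ℝ) :
    ℕ → Cyc d → Cyc d → ℝ≥0∞
  | 0, γ, θ => if γ = θ then 1 else 0
  | n + 1, γ, θ => ∑' γ' : Cyc d, mker V α γ γ' * mpow V α n γ' θ

/-- Translation conjugate. -/
def conjT {d : ℕ} (x : Fin d → ℤ) (θ : Equiv.Perm (Fin d → ℤ)) : Equiv.Perm (Fin d → ℤ) :=
  (Equiv.addRight x)⁻¹ * θ * ((Equiv.addRight x)⁻¹)⁻¹

lemma conjT_apply {d : ℕ} (x : Fin d → ℤ) (θ : Equiv.Perm (Fin d → ℤ)) (y : Fin d → ℤ) :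
    conjT x θ y = θ (y + x) - x := by
  simp [conjT, Equiv.Perm.mul_apply, sub_eq_add_neg]

lemma conjT_inj {d : ℕ} (x : Fin d → ℤ) : Function.Injective (conjT x) := by
  intro a b h
  simpa [conjT] using h

lemma mem_psupp_conjT {d : ℕ} (x : Fin d → ℤ) (θ : Equiv.Perm (Fin d → ℤ)) (y : Fin d → ℤ) :
    y ∈ psupp (conjT x θ) ↔ y + x ∈ psupp θ := by
  simp [psupp, conjT_apply, sub_eq_iff_eq_add]

lemma psupp_conjT {d : ℕ} (x : Fin d → ℤ) (θ : Equiv.Perm (Fin d → ℤ)) :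
    psupp θ = (fun y => y + x) '' psupp (conjT x θ) := by
  ext y
  constructor
  · intro h
    exact ⟨y - x, by rw [mem_psupp_conjT]; simpa using h, by simp⟩
  · rintro ⟨z, hz, rfl⟩
    exact (mem_psupp_conjT x θ z).1 hz

lemma ncard_conjT {d : ℕ} (x : Fin d → ℤ) (θ : Equiv.Perm (Fin d → ℤ)) :
    (psupp (conjT x θ)).ncard = (psupp θ).ncard := by
  rw [psupp_conjT x θ, Set.ncard_image_of_injective _ (add_left_injective x)]

lemma w_conjT {d : ℕ} (V : (Fin d → ℤ) → ℝ) (α : ℝ) (x : Fin d → ℤ)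
    (θ : Equiv.Perm (Fin d → ℤ)) : w V α (conjT x θ) = w V α θ := by
  unfold w
  rw [psupp_conjT x θ, finsum_mem_image (add_left_injective x).injOn]
  congr 2
  refine finsum_congr fun y => ?_
  refine finsum_congr fun _ => ?_
  rw [conjT_apply]
  congr 1
  abel

lemma isFiniteCycle_conjT {d : ℕ} (x : Fin d → ℤ) (θ : Equiv.Perm (Fin d → ℤ))
    (h : IsFiniteCycle θ) : IsFiniteCycle (conjT x θ) := by
  refine ⟨h.1.conj, ?_⟩
  have h2 := h.2
  rw [psupp_conjT x θ] at h2
  exact Set.Finite.of_finite_image h2 (add_left_injective x).injOn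

open Classical in
lemma sum_at_le {d : ℕ} (V : (Fin d → ℤ) → ℝ) (α : ℝ) (x : Fin d → ℤ) :
    (∑' θ : Cyc d, if x ∈ psupp θ.1 then
      ((psupp θ.1).ncard : ℝ≥0∞) * ENNReal.ofReal (w V α θ.1) else 0) ≤ beta V α := by
  let g : Cyc d → ℝ≥0∞ := fun θ => ((psupp θ.1).ncard : ℝ≥0∞) * ENNReal.ofReal (w V α θ.1)
  have h1 : (∑' θ : Cyc d, if x ∈ psupp θ.1 then
      ((psupp θ.1).ncard : ℝ≥0∞) * ENNReal.ofReal (w V α θ.1) else 0)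
      = ∑' θ : {θ : Cyc d | x ∈ psupp θ.1}, g θ := by
    rw [tsum_subtype]
    rfl
  rw [h1]
  let f : {θ : Cyc d | x ∈ psupp θ.1} →
      {θ : Equiv.Perm (Fin d → ℤ) // IsFiniteCycle θ ∧ (0 : Fin d → ℤ) ∈ psupp θ} :=
    fun θ => ⟨conjT x θ.1.1, isFiniteCycle_conjT x _ θ.1.2, by
      rw [mem_psupp_conjT, zero_add]; exact θ.2⟩
  have hf : Function.Injective f := by
    intro a b h
    have := conjT_inj x (congrArg Subtype.val h)
    exact Subtype.ext (Subtype.ext this)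
  unfold beta
  refine le_trans (le_of_eq ?_) (ENNReal.tsum_comp_le_tsum_of_injective hf _)
  refine tsum_congr fun θ => ?_
  simp only [f, g, ncard_conjT, w_conjT]

lemma key {d : ℕ} (V : (Fin d → ℤ) → ℝ) (α : ℝ) (γ : Cyc d) :
    (∑' θ : Cyc d, mker V α γ θ * ((psupp θ.1).ncard : ℝ≥0∞))
      ≤ ((psupp γ.1).ncard : ℝ≥0∞) * beta V α := by
  classical
  have hfin := γ.2.2
  calc (∑' θ : Cyc d, mker V α γ θ * ((psupp θ.1).ncard : ℝ≥0∞))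
      ≤ ∑' θ : Cyc d, ∑ x ∈ hfin.toFinset, (if x ∈ psupp θ.1 then
      ((psupp θ.1).ncard : ℝ≥0∞) * ENNReal.ofReal (w V α θ.1) else 0) := by
        refine ENNReal.tsum_le_tsum fun θ => ?_
        unfold mker
        split_ifs with h
        · obtain ⟨x, hx, hx'⟩ := h
          refine le_trans ?_ (Finset.single_le_sum (fun _ _ => zero_le)
            (hfin.mem_toFinset.2 hx))
          rw [if_pos hx', mul_comm]
        · simp
    _ = ∑ x ∈ hfin.toFinset, ∑' θ : Cyc d, (if x ∈ psupp θ.1 then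
      ((psupp θ.1).ncard : ℝ≥0∞) * ENNReal.ofReal (w V α θ.1) else 0) :=
        Summable.tsum_finsetSum fun _ _ => ENNReal.summable
    _ ≤ ∑ x ∈ hfin.toFinset, beta V α := Finset.sum_le_sum fun x _ => sum_at_le V α x
    _ = _ := by
        rw [Finset.sum_const, nsmul_eq_mul, Set.ncard_eq_toFinset_card _ hfin]

lemma pow_bound {d : ℕ} (V : (Fin d → ℤ) → ℝ) (α : ℝ) (n : ℕ) : ∀ γ : Cyc d,
    (∑' θ : Cyc d, mpow V α n γ θ) ≤ ((psupp γ.1).ncard : ℝ≥0∞) * (beta V α) ^ n := by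
  classical
  induction n with
  | zero =>
    intro γ
    obtain ⟨x, hx, -⟩ := γ.2.1
    have h : 1 ≤ (psupp γ.1).ncard := (Set.ncard_pos γ.2.2).2 ⟨x, hx⟩
    have : (∑' θ : Cyc d, mpow V α 0 γ θ) = 1 := by
      simp only [mpow]
      rw [tsum_eq_single γ]
      · simp
      · intro b hb
        simp [hb.symm]
    rw [this]
    simpa using h
  | succ n ih =>
    intro γ
    calc (∑' θ : Cyc d, mpow V α (n + 1) γ θ)
        = ∑' γ' : Cyc d, mker V α γ γ' * ∑' θ : Cyc d, mpow V α n γ' θ := by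
          simp only [mpow]
          rw [ENNReal.tsum_comm]
          simp only [ENNReal.tsum_mul_left]
      _ ≤ ∑' γ' : Cyc d, mker V α γ γ' * ((psupp γ'.1).ncard : ℝ≥0∞) * beta V α ^ n := by
          refine ENNReal.tsum_le_tsum fun γ' => ?_
          rw [mul_assoc]
          gcongr
          exact ih γ'
      _ ≤ ((psupp γ.1).ncard : ℝ≥0∞) * beta V α * beta V α ^ n := by
          rw [ENNReal.tsum_mul_right]
          gcongr
          exact key V α γ
      _ = _ := by rw [pow_succ']; ring

/-- For every finite cycle `γ` and every `n ≥ 1`,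
`∑_θ m^n(γ,θ) ≤ |γ| β(V,α)^n`; consequently, if `β(V,α) < 1` then
`∑_{n ≥ 1} ∑_θ m^n(γ,θ) ≤ |γ| β/(1−β)`, which is finite. -/
theorem mean_matrix_power_bound (d : ℕ) (hd : 1 ≤ d)
    (V : (Fin d → ℤ) → ℝ) (α : ℝ) (hα : 0 < α) :
    (∀ (γ : Cyc d) (n : ℕ), 1 ≤ n →
      (∑' θ : Cyc d, mpow V α n γ θ)
        ≤ ((psupp γ.1).ncard : ℝ≥0∞) * (beta V α) ^ n) ∧
    (beta V α < 1 → ∀ γ : Cyc d,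
      (∑' n : ℕ, ∑' θ : Cyc d, mpow V α (n + 1) γ θ)
        ≤ ((psupp γ.1).ncard : ℝ≥0∞) * (beta V α / (1 - beta V α)) ∧
      ((psupp γ.1).ncard : ℝ≥0∞) * (beta V α / (1 - beta V α)) < ⊤) := by
  refine ⟨fun γ n _ => pow_bound V α n γ, fun hb γ => ⟨?_, ?_⟩⟩
  · calc (∑' n : ℕ, ∑' θ : Cyc d, mpow V α (n + 1) γ θ)
        ≤ ∑' n : ℕ, ((psupp γ.1).ncard : ℝ≥0∞) * (beta V α * beta V α ^ n) :=
          ENNReal.tsum_le_tsum fun n => by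
            rw [← pow_succ']; exact pow_bound V α (n + 1) γ
      _ = _ := by
          rw [ENNReal.tsum_mul_left, ENNReal.tsum_mul_left, ENNReal.tsum_geometric, div_eq_mul_inv]
  · refine ENNReal.mul_lt_top (ENNReal.natCast_lt_top _) ?_
    exact ENNReal.div_lt_top hb.ne_top (tsub_pos_of_lt hb).ne'
end

section
/- Let d ≥ 1, V : ℤ^d → ℝ, α > 0, and set ρ := ρ(V,α) and β := β(V,α). If ρ < 1, then β ≤ ρ/(1−ρ)² − ρ. -/
open scoped ENNReal

/-- `ρ(V,α) = ∑_{x ∈ ℤ^d, x ≠ 0} exp(−α V(x))`, summed in `[0,∞]`. -/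
noncomputable def rho {d : ℕ} (V : (Fin d → ℤ) → ℝ) (α : ℝ) : ℝ≥0∞ :=
  ∑' x : {x : Fin d → ℤ // x ≠ 0}, ENNReal.ofReal (Real.exp (-α * V x.1))

lemma aux_tsum_prod {X : Type*} (e : X → ℝ≥0∞) (n : ℕ) :
    ∑' v : Fin n → X, ∏ i, e (v i) = (∑' x, e x) ^ n := by
  induction n with
  | zero => simp
  | succ n ih =>
    rw [← (Fin.consEquiv (fun _ : Fin (n+1) => X)).tsum_eq, ENNReal.tsum_prod', pow_succ', ← ih]
    simp [Fin.consEquiv, Fin.prod_univ_succ, ENNReal.tsum_mul_left, ENNReal.tsum_mul_right]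

lemma aux_num (r : ℝ≥0∞) (hr : r < 1) :
    ∑' n : ℕ, (if 2 ≤ n then (n : ℝ≥0∞) else 0) * r ^ n ≤ r / (1 - r) ^ 2 - r := by
  have hr' : r ≠ ∞ := (hr.trans ENNReal.one_lt_top).ne
  apply ENNReal.le_sub_of_add_le_right hr'
  have h1 : ∑' n : ℕ, (if 2 ≤ n then (n : ℝ≥0∞) else 0) * r ^ n + r
      = ∑' n : ℕ, (n : ℝ≥0∞) * r ^ n := by
    have : r = ∑' n : ℕ, if n = 1 then r else 0 := by simp
    nth_rewrite 2 [this]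
    rw [← ENNReal.tsum_add]
    congr 1; ext n
    rcases n with _ | _ | n <;> simp
  rw [h1]
  lift r to NNReal using hr'
  have hr2 : (r : ℝ) < 1 := by exact_mod_cast hr
  have h := hasSum_coe_mul_geometric_of_norm_lt_one (r := (r:ℝ)) (by simpa using hr2)
  have h3 : HasSum (fun n : ℕ => (n : NNReal) * r ^ n) (r / (1 - r) ^ 2) := by
    rw [← NNReal.hasSum_coe]
    push_cast [NNReal.coe_sub (show r ≤ 1 from by exact_mod_cast hr.le)]
    exact h
  have h4 := (ENNReal.hasSum_coe.2 h3).tsum_eq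
  have h0 : (1 - r) ^ 2 ≠ 0 := by
    apply pow_ne_zero
    exact (tsub_pos_of_lt (by exact_mod_cast hr)).ne'
  push_cast [ENNReal.coe_div h0] at h4
  exact h4.le

lemma aux_period {X : Type*} (θ : Equiv.Perm X) (hc : θ.IsCycle) (hf : {x | θ x ≠ x}.Finite)
    (a : X) (ha : θ a ≠ a) :
    ∃ p : ℕ, 2 ≤ p ∧ {x | θ x ≠ x} = (fun i : ℕ => (θ ^ i) a) '' Set.Iio p ∧
      Set.InjOn (fun i : ℕ => (θ ^ i) a) (Set.Iio p) := by
  have hmem : ∀ i : ℕ, θ ((θ ^ i) a) ≠ (θ ^ i) a := by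
    intro i h
    apply ha
    rw [← Equiv.Perm.mul_apply, ← pow_succ', pow_succ, Equiv.Perm.mul_apply] at h
    exact (θ ^ i).injective h
  have hinj : Set.InjOn (fun i : ℕ => (θ ^ i) a) (Set.Iio (Function.minimalPeriod θ a)) := by
    have := Function.iterate_injOn_Iio_minimalPeriod (f := θ) (x := a)
    simpa [Equiv.Perm.iterate_eq_pow] using this
  have hp : 0 < Function.minimalPeriod θ a := by
    by_contra h
    have h0 : Function.minimalPeriod θ a = 0 := by omega
    have hni : ¬ Function.Injective (fun i : ℕ => (θ ^ i) a) := by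
      intro hi
      exact (Set.infinite_of_injective_forall_mem hi hmem) hf
    apply hni
    intro i j hij
    wlog hle : i ≤ j generalizing i j
    · exact (this hij.symm (by omega)).symm
    obtain ⟨k, rfl⟩ := Nat.exists_eq_add_of_le hle
    simp only [pow_add, Equiv.Perm.mul_apply] at hij
    have hk : (θ ^ k) a = a := ((θ ^ i).injective hij).symm
    have : Function.IsPeriodicPt θ k a := by
      simpa [Function.IsPeriodicPt, Function.IsFixedPt, Equiv.Perm.iterate_eq_pow] using hk
    have := this.minimalPeriod_dvd
    rw [h0] at this
    simp at this; omega
  refine ⟨Function.minimalPeriod θ a, ?_, ?_, hinj⟩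
  · by_contra h
    have : Function.minimalPeriod θ a = 1 := by omega
    exact ha (Function.minimalPeriod_eq_one_iff_isFixedPt.1 this)
  · ext x
    constructor
    · intro hx
      obtain ⟨i, rfl⟩ := hc.sameCycle ha hx
      have h1 := MulAction.zpow_smul_mod_minimalPeriod θ a i
      change (θ ^ (i % (Function.minimalPeriod θ a : ℤ))) a = (θ ^ i) a at h1
      have hn := Int.emod_nonneg i (b := (Function.minimalPeriod θ a : ℤ)) (by omega)
      have hl := Int.emod_lt_of_pos i (b := (Function.minimalPeriod θ a : ℤ)) (by omega)
      refine ⟨(i % (Function.minimalPeriod θ a : ℤ)).toNat, ?_, ?_⟩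
      · simp only [Set.mem_Iio]; omega
      · rw [← h1]
        conv_rhs => rw [← Int.toNat_of_nonneg hn]
        rw [zpow_natCast]
    · rintro ⟨i, -, rfl⟩
      exact hmem i

lemma aux_period' {d : ℕ} (θ : Equiv.Perm (Fin d → ℤ)) (hc : IsFiniteCycle θ)
    (ha : (0 : Fin d → ℤ) ∈ psupp θ) :
    2 ≤ (psupp θ).ncard ∧ psupp θ = (fun i : ℕ => (θ ^ i) 0) '' Set.Iio (psupp θ).ncard ∧
      Set.InjOn (fun i : ℕ => (θ ^ i) 0) (Set.Iio (psupp θ).ncard) := by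
  obtain ⟨p, h2, he, hi⟩ := aux_period θ hc.1 hc.2 0 ha
  change psupp θ = _ at he
  have : (psupp θ).ncard = p := by
    rw [he, Set.ncard_image_of_injOn hi]
    rw [← Finset.coe_range, Set.ncard_coe_finset, Finset.card_range]
  rw [this]; exact ⟨h2, he, hi⟩

abbrev auxT (d : ℕ) :=
  {θ : Equiv.Perm (Fin d → ℤ) // IsFiniteCycle θ ∧ (0 : Fin d → ℤ) ∈ psupp θ}

abbrev auxS (d : ℕ) := Σ n : ℕ, (Fin n → {x : Fin d → ℤ // x ≠ 0})

noncomputable def auxF {d : ℕ} (θ : auxT d) : auxS d :=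
  ⟨(psupp θ.1).ncard, fun i => ⟨(θ.1 ^ (i.1 + 1)) 0 - (θ.1 ^ i.1) 0, by
    rw [sub_ne_zero, pow_succ]
    intro h
    exact θ.2.2 ((θ.1 ^ i.1).injective h)⟩⟩

def auxStep {d : ℕ} (s : auxS d) (i : ℕ) : Fin d → ℤ :=
  if h : i < s.1 then (s.2 ⟨i, h⟩).1 else 0

lemma auxF_inj {d : ℕ} : Function.Injective (auxF (d := d)) := by
  rintro ⟨θ, hθ⟩ ⟨η, hη⟩ h
  have hn : (psupp θ).ncard = (psupp η).ncard := congrArg Sigma.fst h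
  have hs : ∀ i < (psupp θ).ncard,
      (θ ^ (i + 1)) 0 - (θ ^ i) 0 = (η ^ (i + 1)) 0 - (η ^ i) 0 := by
    intro i hi
    have := congrArg (fun s => auxStep s i) h
    simpa [auxStep, auxF, hi, hn ▸ hi] using this
  have hp : ∀ i ≤ (psupp θ).ncard, (θ ^ i) 0 = (η ^ i) 0 := by
    intro i
    induction i with
    | zero => simp
    | succ i ih =>
      intro hi
      have h1 := hs i (by omega)
      rw [ih (by omega)] at h1
      exact sub_left_injective h1
  obtain ⟨-, h1, -⟩ := aux_period' θ hθ.1 hθ.2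
  obtain ⟨-, h2, -⟩ := aux_period' η hη.1 hη.2
  have hsup : psupp θ = psupp η := by
    rw [h1, h2, ← hn]
    apply Set.image_congr
    intro i hi
    exact hp i (le_of_lt hi)
  congr 1
  ext1 x
  by_cases hx : x ∈ psupp θ
  · have hx' := hx
    rw [h1] at hx'
    obtain ⟨i, hi, rfl⟩ := hx'
    have a := hp (i+1) hi
    have b := hp i (le_of_lt hi)
    simp only [pow_succ', Equiv.Perm.mul_apply] at a
    simp only
    rw [a, b]
  · have hx2 : x ∉ psupp η := hsup ▸ hx
    simp only [psupp, Set.mem_setOf_eq, not_not] at hx hx2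
    rw [hx, hx2]

lemma aux_weight {d : ℕ} (V : (Fin d → ℤ) → ℝ) (α : ℝ) (θ : auxT d) :
    ENNReal.ofReal (w V α θ.1) =
      ∏ i, ENNReal.ofReal (Real.exp (-α * V ((auxF θ).2 i).1)) := by
  obtain ⟨-, h1, h2⟩ := aux_period' θ.1 θ.2.1 θ.2.2
  rw [← ENNReal.ofReal_prod_of_nonneg (fun _ _ => (Real.exp_pos _).le), ← Real.exp_sum, w]
  congr 2
  rw [← Finset.mul_sum]
  congr 1
  calc _ = ∑ᶠ x ∈ (fun i : ℕ => (θ.1 ^ i) 0) '' Set.Iio (psupp θ.1).ncard, V (θ.1 x - x) := by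
        rw [← h1]
    _ = _ := by
        rw [finsum_mem_image h2, ← Finset.coe_range, finsum_mem_coe_finset,
          Finset.sum_range]
        apply Finset.sum_congr rfl
        intro i _
        simp [auxF, pow_succ']

/-- If `ρ = ρ(V,α) < 1`, then `β(V,α) ≤ ρ/(1−ρ)² − ρ`. -/
theorem beta_le_of_rho_lt_one (d : ℕ) (hd : 1 ≤ d)
    (V : (Fin d → ℤ) → ℝ) (α : ℝ) (hα : 0 < α) (hρ : rho V α < 1) :
    beta V α ≤ rho V α / (1 - rho V α) ^ 2 - rho V α := by
  let g : auxS d → ℝ≥0∞ := fun s => (if 2 ≤ s.1 then (s.1 : ℝ≥0∞) else 0) *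
    ∏ i, ENNReal.ofReal (Real.exp (-α * V (s.2 i).1))
  calc beta V α = ∑' θ : auxT d, g (auxF θ) := by
        apply tsum_congr
        intro θ
        have h := (aux_period' θ.1 θ.2.1 θ.2.2).1
        simp only [g]
        rw [← aux_weight, if_pos (show 2 ≤ (auxF θ).1 from h)]
        rfl
    _ ≤ ∑' s, g s := ENNReal.tsum_comp_le_tsum_of_injective auxF_inj g
    _ = ∑' n : ℕ, (if 2 ≤ n then (n : ℝ≥0∞) else 0) * rho V α ^ n := by
        rw [ENNReal.tsum_sigma']
        apply tsum_congr
        intro n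
        simp only [g]
        rw [ENNReal.tsum_mul_left,
          aux_tsum_prod (fun x : {x : Fin d → ℤ // x ≠ 0} =>
            ENNReal.ofReal (Real.exp (-α * V x.1)))]
        rfl
    _ ≤ _ := aux_num _ hρ
end

section
/- Let d ≥ 1, V : ℤ^d → ℝ, α > 0, and n ≥ 2. Then, with sums taken in [0,∞], Σ over finite cycles θ of ℤ^d with 0 ∈ supp θ and |θ| = n of w(θ) is at most ρ(V,α)^n. -/
open scoped ENNReal

theorem tsum_pi_prod_eq {β : Type*} (f : β → ℝ≥0∞) (n : ℕ) :
    ∑' g : Fin n → β, ∏ i, f (g i) = (∑' x, f x) ^ n := by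
  induction n with
  | zero => simp
  | succ n ih =>
    rw [← (Fin.consEquiv (fun _ : Fin (n+1) => β)).tsum_eq, ENNReal.tsum_prod', pow_succ', ← ih,
      ← ENNReal.tsum_mul_right]
    refine tsum_congr fun x => ?_
    rw [← ENNReal.tsum_mul_left]
    refine tsum_congr fun g => ?_
    simp [Fin.consEquiv, Fin.prod_univ_succ]

theorem cyc_facts {d : ℕ} {θ : Equiv.Perm (Fin d → ℤ)} {n : ℕ}
    (h : IsFiniteCycle θ ∧ (0 : Fin d → ℤ) ∈ psupp θ ∧ (psupp θ).ncard = n) :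
    Set.BijOn (fun i : ℕ => (θ ^ i) 0) (Finset.range n) (psupp θ) := by
  obtain ⟨⟨hc, hf⟩, h0, hn⟩ := h
  have hon : θ.IsCycleOn (hf.toFinset : Set _) := by
    rw [hf.coe_toFinset]; exact hc.isCycleOn
  have h0' : (0 : Fin d → ℤ) ∈ hf.toFinset := by simpa using h0
  have hcard : hf.toFinset.card = n := by
    rw [← hn, Set.ncard_eq_toFinset_card _ hf]
  refine ⟨fun i _ => ?_, fun i hi j hj hij => ?_, fun y hy => ?_⟩
  · have := (hon.1.perm_pow i).mapsTo (Finset.mem_coe.2 h0')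
    rwa [hf.coe_toFinset] at this
  · have := (hon.pow_apply_eq_pow_apply h0').1 hij
    rw [hcard] at this
    exact Nat.ModEq.eq_of_lt_of_lt this (by simpa using hi) (by simpa using hj)
  · obtain ⟨m, hm, he⟩ := hon.exists_pow_eq h0' (hf.mem_toFinset.2 hy)
    exact ⟨m, by simpa [← hcard] using hm, he⟩

theorem sum_weights_cycles_through_origin_of_length_le (d : ℕ) (hd : 1 ≤ d)
    (V : (Fin d → ℤ) → ℝ) (α : ℝ) (hα : 0 < α) (n : ℕ) (hn : 2 ≤ n) :
    (∑' θ : {θ : Equiv.Perm (Fin d → ℤ) //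
        IsFiniteCycle θ ∧ (0 : Fin d → ℤ) ∈ psupp θ ∧ (psupp θ).ncard = n},
      ENNReal.ofReal (w V α θ.1)) ≤ (rho V α) ^ n := by
  rw [rho, ← tsum_pi_prod_eq]
  let F : {θ : Equiv.Perm (Fin d → ℤ) //
        IsFiniteCycle θ ∧ (0 : Fin d → ℤ) ∈ psupp θ ∧ (psupp θ).ncard = n} →
      Fin n → {x : Fin d → ℤ // x ≠ 0} := fun θ i =>
    ⟨θ.1 ((θ.1 ^ (i : ℕ)) 0) - (θ.1 ^ (i : ℕ)) 0,
      sub_ne_zero.2 ((cyc_facts θ.2).mapsTo (by simp))⟩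
  have hF : Function.Injective F := by
    intro θ η h
    have hstep : ∀ i < n, θ.1 ((θ.1 ^ i) 0) - (θ.1 ^ i) 0 = η.1 ((η.1 ^ i) 0) - (η.1 ^ i) 0 :=
      fun i hi => congrArg Subtype.val (congrFun h ⟨i, hi⟩)
    have hpow : ∀ i ≤ n, (θ.1 ^ i) 0 = (η.1 ^ i) 0 := by
      intro i
      induction i with
      | zero => intro _; simp
      | succ i ih =>
        intro hi
        have h1 := ih (by omega)
        have h2 := hstep i (by omega)
        rw [h1] at h2
        rw [pow_succ', pow_succ', Equiv.Perm.mul_apply, Equiv.Perm.mul_apply, h1]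
        exact sub_left_injective h2
    have hs : psupp θ.1 = psupp η.1 := by
      rw [← (cyc_facts θ.2).image_eq, ← (cyc_facts η.2).image_eq]
      refine Set.image_congr fun i hi => hpow i ?_
      have : i < n := by simpa using hi
      exact this.le
    refine Subtype.ext (Equiv.ext fun x => ?_)
    by_cases hx : x ∈ psupp θ.1
    · obtain ⟨i, hi, rfl⟩ := (cyc_facts θ.2).surjOn hx
      have hi : i < n := by simpa using hi
      have h2 := hpow (i+1) hi
      rw [pow_succ', pow_succ', Equiv.Perm.mul_apply, Equiv.Perm.mul_apply, ← hpow i hi.le] at h2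
      exact h2
    · have hx' := hx
      rw [hs] at hx'
      rw [not_not.1 hx, not_not.1 hx']
  refine le_trans (le_of_eq (tsum_congr fun θ => ?_))
    (ENNReal.tsum_comp_le_tsum_of_injective hF _)
  rw [← ENNReal.ofReal_prod_of_nonneg (fun _ _ => (Real.exp_pos _).le), ← Real.exp_sum,
    ← Finset.mul_sum, w]
  congr 4
  have hb := cyc_facts θ.2
  rw [← finsum_mem_eq_of_bijOn (f := fun i : ℕ => V (θ.1 ((θ.1 ^ i) 0) - (θ.1 ^ i) 0)) _ hb
    (fun _ _ => rfl), finsum_mem_coe_finset, Finset.sum_range]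
end

section
/- Let d ≥ 1, V : ℤ^d → ℝ and α > 0, and let ρ₀ ∈ (0,1) satisfy ρ₀/(1−ρ₀)² − ρ₀ = 1. If ρ(V,α) < ρ₀, then β(V,α) < 1. -/
open scoped ENNReal

theorem aux_tsum_pow {X : Type*} (f : X → ℝ≥0∞) (n : ℕ) :
    ∑' c : Fin n → X, ∏ i, f (c i) = (∑' x, f x) ^ n := by
  induction n with
  | zero => simp
  | succ n ih =>
    rw [← (Fin.consEquiv (fun _ : Fin (n+1) => X)).tsum_eq, ENNReal.tsum_prod']
    simp only [Fin.consEquiv, Equiv.coe_fn_mk, Fin.prod_univ_succ, Fin.cons_zero, Fin.cons_succ]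
    simp_rw [ENNReal.tsum_mul_left, ENNReal.tsum_mul_right]
    rw [ih, pow_succ']

theorem aux_sigma {X : Type*} {n m : ℕ} {g g' : ℕ → X}
    (h : (⟨n, fun i => g i⟩ : Σ n : ℕ, (Fin n → X)) = ⟨m, fun i => g' i⟩) :
    n = m ∧ ∀ i < n, g i = g' i := by
  rw [Sigma.mk.inj_iff] at h
  obtain ⟨rfl, h⟩ := h
  refine ⟨rfl, fun i hi => ?_⟩
  exact congrFun (eq_of_heq h) ⟨i, hi⟩

theorem aux_real {r ρ₀ : ℝ} (hr : 0 ≤ r) (hlt : r < ρ₀) (h1 : ρ₀ < 1)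
    (heq : ρ₀ / (1 - ρ₀) ^ 2 - ρ₀ = 1) : r / (1 - r) ^ 2 - r < 1 := by
  have hp : 0 < ρ₀ := lt_of_le_of_lt hr hlt
  have e1 : 1 / (1 - r) ^ 2 ≤ 1 / (1 - ρ₀) ^ 2 := by
    apply one_div_le_one_div_of_le
    · have : 0 < 1 - ρ₀ := by linarith
      positivity
    · apply pow_le_pow_left₀ <;> linarith
  have e2 : ρ₀ * (1 / (1 - ρ₀) ^ 2 - 1) = 1 := by rw [mul_sub, mul_one_div, mul_one]; exact heq
  have e3 : 0 < 1 / (1 - ρ₀) ^ 2 - 1 := by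
    by_contra hc
    nlinarith
  calc r / (1 - r) ^ 2 - r = r * (1 / (1 - r) ^ 2 - 1) := by ring
    _ ≤ r * (1 / (1 - ρ₀) ^ 2 - 1) := by apply mul_le_mul_of_nonneg_left _ hr; linarith
    _ < ρ₀ * (1 / (1 - ρ₀) ^ 2 - 1) := mul_lt_mul_of_pos_right hlt e3
    _ = 1 := e2

theorem aux_series {r : ℝ} (hr : 0 ≤ r) (h1 : r < 1) :
    ∑' n : ℕ, (if 2 ≤ n then (n : ℝ≥0∞) * (ENNReal.ofReal r) ^ n else 0)
      = ENNReal.ofReal (r / (1 - r) ^ 2 - r) := by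
  have hs : HasSum (fun n : ℕ => (n : ℝ) * r ^ n) (r / (1 - r) ^ 2) :=
    hasSum_coe_mul_geometric_of_norm_lt_one (by rwa [Real.norm_of_nonneg hr])
  have hs2 := hs.sub (hasSum_ite_eq (1 : ℕ) r)
  rw [← hs2.tsum_eq, ENNReal.ofReal_tsum_of_nonneg _ hs2.summable]
  · congr 1
    ext1 n
    rcases n with _ | _ | n
    · simp
    · simp
    · rw [if_pos (by omega), if_neg (by omega), sub_zero, ENNReal.ofReal_mul (Nat.cast_nonneg _),
        ENNReal.ofReal_pow hr, ENNReal.ofReal_natCast]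
  · intro n
    rcases n with _ | _ | n
    · simp
    · simp
    · simp; positivity

section
variable {d : ℕ} {θ : Equiv.Perm (Fin d → ℤ)}

theorem aux_ne (h0 : (0 : Fin d → ℤ) ∈ psupp θ) (i : ℕ) : θ (θ^[i] 0) - θ^[i] 0 ≠ 0 := by
  rw [sub_ne_zero, ← Function.iterate_succ_apply' θ, Function.iterate_succ_apply]
  intro h
  exact h0 ((θ.injective.iterate i) h)

theorem aux_mem (h0 : (0 : Fin d → ℤ) ∈ psupp θ) (i : ℕ) : θ^[i] 0 ∈ psupp θ :=
  fun h => aux_ne h0 i (by rw [h, sub_self])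

theorem aux_periodic (hf : IsFiniteCycle θ) (h0 : (0 : Fin d → ℤ) ∈ psupp θ) :
    (0 : Fin d → ℤ) ∈ Function.periodicPts θ := by
  by_contra hc
  have hinj : Function.Injective (fun i : ℕ => θ^[i] (0 : Fin d → ℤ)) := by
    apply Function.Injective.of_lt_imp_ne
    intro i j hij he
    apply hc
    refine ⟨j - i, by omega, ?_⟩
    apply θ.injective.iterate i
    rw [← Function.iterate_add_apply, show i + (j - i) = j by omega]
    exact he.symm
  exact Set.infinite_of_injective_forall_mem hinj (aux_mem h0) hf.2

theorem aux_image (hf : IsFiniteCycle θ) (h0 : (0 : Fin d → ℤ) ∈ psupp θ) :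
    Set.BijOn (fun i : ℕ => θ^[i] (0 : Fin d → ℤ))
      (Set.Iio (Function.minimalPeriod θ 0)) (psupp θ) := by
  have hp := aux_periodic hf h0
  have hpos := Function.minimalPeriod_pos_of_mem_periodicPts hp
  refine ⟨fun i _ => aux_mem h0 i, Function.iterate_injOn_Iio_minimalPeriod, ?_⟩
  intro y hy
  obtain ⟨k, hk⟩ := hf.1.sameCycle h0 hy
  set n := Function.minimalPeriod θ 0
  have hn : (θ ^ n) (0 : Fin d → ℤ) = 0 := by
    rw [← Equiv.Perm.iterate_eq_pow]
    exact Function.isPeriodicPt_minimalPeriod θ 0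
  have hz : ∀ m : ℤ, ((θ ^ n) ^ m) (0 : Fin d → ℤ) = 0 :=
    fun m => Equiv.Perm.zpow_apply_eq_self_of_apply_eq_self hn m
  have hmod := Int.emod_nonneg k (show (n : ℤ) ≠ 0 by omega)
  have hmodlt := Int.emod_lt_of_pos k (show (0 : ℤ) < n by omega)
  refine ⟨(k % n).toNat, ?_, ?_⟩
  · simp only [Set.mem_Iio]; omega
  · simp only
    rw [Equiv.Perm.iterate_eq_pow, ← zpow_natCast, Int.toNat_of_nonneg hmod, ← hk]
    conv_rhs => rw [← Int.emod_add_mul_ediv k n, zpow_add, zpow_mul, Equiv.Perm.mul_apply,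
      zpow_natCast, hz]

theorem aux_card (hf : IsFiniteCycle θ) (h0 : (0 : Fin d → ℤ) ∈ psupp θ) :
    (psupp θ).ncard = Function.minimalPeriod θ 0 := by
  have hb := aux_image hf h0
  rw [← hb.image_eq, Set.ncard_image_of_injOn hb.injOn, ← Finset.coe_Iio, Set.ncard_coe_finset]
  simp

theorem aux_two (hf : IsFiniteCycle θ) (h0 : (0 : Fin d → ℤ) ∈ psupp θ) :
    2 ≤ Function.minimalPeriod θ 0 := by
  have hpos := Function.minimalPeriod_pos_of_mem_periodicPts (aux_periodic hf h0)
  have h1 : Function.minimalPeriod θ 0 ≠ 1 := by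
    rw [Ne, Function.minimalPeriod_eq_one_iff_isFixedPt]
    exact h0
  omega

theorem aux_w (V : (Fin d → ℤ) → ℝ) (α : ℝ)
    (hf : IsFiniteCycle θ) (h0 : (0 : Fin d → ℤ) ∈ psupp θ) :
    ENNReal.ofReal (w V α θ) = ∏ i : Fin (Function.minimalPeriod θ 0),
      ENNReal.ofReal (Real.exp (-α * V (θ (θ^[i] 0) - θ^[i] 0))) := by
  have hb := aux_image hf h0
  rw [← ENNReal.ofReal_prod_of_nonneg (fun _ _ => (Real.exp_pos _).le), ← Real.exp_sum,
    ← Finset.mul_sum, w]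
  congr 4
  rw [← finsum_mem_eq_of_bijOn (f := fun i : ℕ => V (θ (θ^[i] 0) - θ^[i] 0)) _ hb
    (fun _ _ => rfl), ← Finset.coe_Iio, finsum_mem_coe_finset, Nat.Iio_eq_range,
    Finset.sum_range]

end

theorem aux_inj {d : ℕ} {θ η : Equiv.Perm (Fin d → ℤ)}
    (hf : IsFiniteCycle θ) (h0 : (0 : Fin d → ℤ) ∈ psupp θ)
    (hf' : IsFiniteCycle η) (h0' : (0 : Fin d → ℤ) ∈ psupp η)
    (hn : Function.minimalPeriod θ 0 = Function.minimalPeriod η 0)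
    (hs : ∀ i < Function.minimalPeriod θ 0,
      θ (θ^[i] 0) - θ^[i] 0 = η (η^[i] 0) - η^[i] 0) : θ = η := by
  have key : ∀ i ≤ Function.minimalPeriod θ 0, θ^[i] 0 = η^[i] 0 := by
    intro i
    induction i with
    | zero => intro _; rfl
    | succ i ih =>
      intro hi
      have e := ih (by omega)
      have e2 := hs i (by omega)
      rw [Function.iterate_succ_apply', Function.iterate_succ_apply']
      rw [← e] at e2 ⊢
      exact sub_left_injective e2
  have hb := aux_image hf h0
  have hb' := aux_image hf' h0'
  have hsup : psupp θ = psupp η := by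
    rw [← hb.image_eq, ← hb'.image_eq, ← hn]
    exact Set.image_congr fun i hi => key i (le_of_lt hi)
  ext1 x
  by_cases hx : x ∈ psupp θ
  · obtain ⟨i, hi, rfl⟩ := hb.surjOn hx
    have hi' : i < Function.minimalPeriod θ 0 := hi
    have e := key (i+1) (by omega)
    rw [Function.iterate_succ_apply', Function.iterate_succ_apply', ← key i (by omega)] at e
    exact e
  · have hx' : x ∉ psupp η := hsup ▸ hx
    simp only [psupp, Set.mem_setOf_eq, not_not] at hx hx'
    rw [hx, hx']


/-- If `ρ(V,α) < ρ₀`, where `ρ₀ ∈ (0,1)` solves `ρ₀/(1−ρ₀)² − ρ₀ = 1`,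
then `β(V,α) < 1`. -/
theorem beta_lt_one_of_rho_lt_rho0 (d : ℕ) (hd : 1 ≤ d)
    (V : (Fin d → ℤ) → ℝ) (α : ℝ) (hα : 0 < α)
    (ρ₀ : ℝ) (h₀ : ρ₀ ∈ Set.Ioo (0 : ℝ) 1) (heq : ρ₀ / (1 - ρ₀) ^ 2 - ρ₀ = 1)
    (h : rho V α < ENNReal.ofReal ρ₀) :
    beta V α < 1 := by
  have hr : rho V α ≠ ⊤ := (h.trans ENNReal.ofReal_lt_top).ne
  have hlt : (rho V α).toReal < ρ₀ := by
    rwa [← ENNReal.ofReal_toReal hr, ENNReal.ofReal_lt_ofReal_iff h₀.1] at h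
  have hnn : 0 ≤ (rho V α).toReal := ENNReal.toReal_nonneg
  let f : {x : Fin d → ℤ // x ≠ 0} → ℝ≥0∞ := fun x => ENNReal.ofReal (Real.exp (-α * V x.1))
  let F : (Σ n : ℕ, (Fin n → {x : Fin d → ℤ // x ≠ 0})) → ℝ≥0∞ :=
    fun c => if 2 ≤ c.1 then (c.1 : ℝ≥0∞) * ∏ i, f (c.2 i) else 0
  let g : {θ : Equiv.Perm (Fin d → ℤ) // IsFiniteCycle θ ∧ (0 : Fin d → ℤ) ∈ psupp θ} →
      ℕ → {x : Fin d → ℤ // x ≠ 0} :=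
    fun θ i => ⟨θ.1 (θ.1^[i] 0) - θ.1^[i] 0, aux_ne θ.2.2 i⟩
  let code : {θ : Equiv.Perm (Fin d → ℤ) // IsFiniteCycle θ ∧ (0 : Fin d → ℤ) ∈ psupp θ} →
      (Σ n : ℕ, (Fin n → {x : Fin d → ℤ // x ≠ 0})) :=
    fun θ => ⟨Function.minimalPeriod θ.1 0, fun i => g θ i⟩
  have hinj : Function.Injective code := by
    intro θ η he
    obtain ⟨h1, h2⟩ := aux_sigma he
    exact Subtype.ext (aux_inj θ.2.1 θ.2.2 η.2.1 η.2.2 h1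
      (fun i hi => congrArg Subtype.val (h2 i hi)))
  calc beta V α = ∑' θ, F (code θ) := by
        unfold beta
        congr 1
        ext1 θ
        simp only [F, code, g, f]
        rw [if_pos (aux_two θ.2.1 θ.2.2), aux_card θ.2.1 θ.2.2, aux_w V α θ.2.1 θ.2.2]
    _ ≤ ∑' c, F c := ENNReal.tsum_comp_le_tsum_of_injective hinj F
    _ = ∑' n : ℕ, (if 2 ≤ n then (n : ℝ≥0∞) * (ENNReal.ofReal (rho V α).toReal) ^ n else 0) := by
        rw [ENNReal.tsum_sigma']
        congr 1
        ext1 n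
        simp only [F]
        split_ifs
        · rw [ENNReal.tsum_mul_left, aux_tsum_pow, ENNReal.ofReal_toReal hr]
          rfl
        · simp
    _ = _ := aux_series hnn (hlt.trans h₀.2)
    _ < 1 := by
        rw [ENNReal.ofReal_lt_one]
        exact aux_real hnn hlt h₀.2 heq
end

section
/- Let d ≥ 1, let Λ ⊂ ℤ^d be a finite set, let α > 0 and v ∈ ℤ^d, and consider the Gaussian potential. Let S_Λ be the set of permutations σ of ℤ^d with σ(x) = x for all x ∉ Λ (a finite set), and for a permutation ξ set H_Λ(ξ) := Σ_{x ∈ Λ} ‖ξ(x) − x‖². Then for every σ ∈ S_Λ, exp(−α H_Λ(τ_v ∘ σ)) / (Σ_{σ' ∈ S_Λ} exp(−α H_Λ(τ_v ∘ σ'))) = exp(−α H_Λ(σ)) / (Σ_{σ' ∈ S_Λ} exp(−α H_Λ(σ'))), where τ_v(x) := x + v. In other words, the Gaussian specification with τ_v boundary conditions satisfies G_{Λ|τ_v}(τ_v σ) = G_Λ(σ), i.e., G_{Λ|τ_v} = G_Λ τ_v. -/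
/-- The finite-volume Hamiltonian for the Gaussian potential:
`H_Λ(ξ) = ∑_{x ∈ Λ} ‖ξ(x) − x‖²`. -/
noncomputable def HLam {d : ℕ} (Λ : Finset (Fin d → ℤ))
    (ξ : Equiv.Perm (Fin d → ℤ)) : ℝ :=
  ∑ x ∈ Λ, ∑ i, (((ξ x - x) i : ℤ) : ℝ) ^ 2

theorem HLam_shift_aux {d : ℕ} (Λ : Finset (Fin d → ℤ)) (v : Fin d → ℤ)
    (σ : Equiv.Perm (Fin d → ℤ)) (hσ : ∀ x ∉ Λ, σ x = x) :
    HLam Λ ((Equiv.addRight v : Equiv.Perm (Fin d → ℤ)) * σ)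
      = HLam Λ σ + ∑ _x ∈ Λ, ∑ i, ((v i : ℤ) : ℝ) ^ 2 := by
  have key : ∀ i, ∑ x ∈ Λ, ((σ x i : ℤ) : ℝ) = ∑ x ∈ Λ, ((x i : ℤ) : ℝ) := by
    intro i
    refine Equiv.Perm.sum_comp σ Λ (fun x => ((x i : ℤ) : ℝ)) ?_
    intro x hx
    by_contra h
    exact hx (hσ x h)
  have h0 : ∑ x ∈ Λ, ∑ i, 2 * (v i : ℝ) * ((σ x i : ℝ) - (x i : ℝ)) = 0 := by
    rw [Finset.sum_comm]
    refine Finset.sum_eq_zero fun i _ => ?_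
    rw [← Finset.mul_sum, Finset.sum_sub_distrib, key i, sub_self, mul_zero]
  unfold HLam
  rw [← add_zero (_ + _), ← h0, ← Finset.sum_add_distrib, ← Finset.sum_add_distrib]
  refine Finset.sum_congr rfl fun x _ => ?_
  rw [← Finset.sum_add_distrib, ← Finset.sum_add_distrib]
  refine Finset.sum_congr rfl fun i _ => ?_
  simp only [Equiv.Perm.mul_apply, Equiv.coe_addRight, Pi.sub_apply, Pi.add_apply]
  push_cast
  ring

/-- For the Gaussian potential, the specification with `τ_v` boundary conditions equals
the composition of the identity-boundary specification with `τ_v`: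
`G_{Λ|τ_v}(τ_v σ) = G_Λ(σ)` for every `σ ∈ S_Λ`. -/
theorem gaussian_shift_specification (d : ℕ) (hd : 1 ≤ d)
    (Λ : Finset (Fin d → ℤ)) (α : ℝ) (hα : 0 < α) (v : Fin d → ℤ)
    (σ : Equiv.Perm (Fin d → ℤ)) (hσ : ∀ x ∉ Λ, σ x = x) :
    Real.exp (-α * HLam Λ ((Equiv.addRight v : Equiv.Perm (Fin d → ℤ)) * σ)) /
      (∑' σ' : {σ' : Equiv.Perm (Fin d → ℤ) // ∀ x ∉ Λ, σ' x = x},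
        Real.exp (-α * HLam Λ ((Equiv.addRight v : Equiv.Perm (Fin d → ℤ)) * σ'.1)))
    = Real.exp (-α * HLam Λ σ) /
      (∑' σ' : {σ' : Equiv.Perm (Fin d → ℤ) // ∀ x ∉ Λ, σ' x = x},
        Real.exp (-α * HLam Λ σ'.1)) := by
  have e : ∀ τ : Equiv.Perm (Fin d → ℤ), (∀ x ∉ Λ, τ x = x) →
      Real.exp (-α * HLam Λ ((Equiv.addRight v : Equiv.Perm (Fin d → ℤ)) * τ))
        = Real.exp (-α * ∑ _x ∈ Λ, ∑ i, ((v i : ℤ) : ℝ) ^ 2) * Real.exp (-α * HLam Λ τ) := by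
    intro τ hτ
    rw [HLam_shift_aux Λ v τ hτ, ← Real.exp_add]
    congr 1
    ring
  rw [e σ hσ, tsum_congr (fun σ' : {σ' : Equiv.Perm (Fin d → ℤ) // ∀ x ∉ Λ, σ' x = x} =>
    e σ'.1 σ'.2), tsum_mul_left]
  exact mul_div_mul_left _ _ (Real.exp_ne_zero _)
end

section
/- Let d ≥ 1, let V : ℝ^d → ℝ be differentiable, let m > 0 and v ∈ ℤ^d, and assume the strong-convexity-type lower bound V(y) ≥ V(x) + ⟨∇V(x), y − x⟩ + m‖y − x‖² for all x, y ∈ ℝ^d. Then for every finite-support permutation γ of ℤ^d: Σ_{x ∈ supp γ} [V(γ(x) + v − x) − V(v)] ≥ m · Σ_{x ∈ supp γ} ‖γ(x) − x‖², where lattice points are viewed in ℝ^d and ‖·‖ is the Euclidean norm. -/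
/-- The embedding of the lattice `ℤ^d` into Euclidean space `ℝ^d`. -/
noncomputable def embE {d : ℕ} (x : Fin d → ℤ) : EuclideanSpace ℝ (Fin d) :=
  (EuclideanSpace.equiv (Fin d) ℝ).symm fun i => (x i : ℝ)

/-- If `V` satisfies the strong-convexity-type bound
`V(y) ≥ V(x) + ⟨∇V(x), y − x⟩ + m‖y − x‖²`, then for every finite-support
permutation `γ` of `ℤ^d` and every `v ∈ ℤ^d`,
`∑_{x ∈ supp γ} [V(γ(x) + v − x) − V(v)] ≥ m ∑_{x ∈ supp γ} ‖γ(x) − x‖²`. -/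
theorem strong_convexity_energy_bound (d : ℕ) (hd : 1 ≤ d)
    (V : EuclideanSpace ℝ (Fin d) → ℝ) (hdiff : Differentiable ℝ V)
    (m : ℝ) (hm : 0 < m) (v : Fin d → ℤ)
    (hconv : ∀ x y : EuclideanSpace ℝ (Fin d),
      V x + inner ℝ (gradient V x) (y - x) + m * ‖y - x‖ ^ 2 ≤ V y)
    (γ : Equiv.Perm (Fin d → ℤ)) (hfin : {x | γ x ≠ x}.Finite) :
    m * ∑ x ∈ hfin.toFinset, ‖embE (γ x - x)‖ ^ 2
      ≤ ∑ x ∈ hfin.toFinset, (V (embE (γ x + v - x)) - V (embE v)) := by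
  have hadd : ∀ a b : Fin d → ℤ, embE (a - b) = embE a - embE b := by
    intro a b
    ext i
    simp [embE]
  have hadd2 : ∀ a b : Fin d → ℤ, embE (a + b) = embE a + embE b := by
    intro a b
    ext i
    simp [embE]
  have hsum : ∑ x ∈ hfin.toFinset, embE (γ x - x) = 0 := by
    simp only [hadd, Finset.sum_sub_distrib]
    rw [Equiv.Perm.sum_comp γ hfin.toFinset embE (by simp), sub_self]
  have hinner : ∑ x ∈ hfin.toFinset, inner ℝ (gradient V (embE v)) (embE (γ x - x)) = 0 := by
    rw [← inner_sum, hsum, inner_zero_right]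
  have key : ∑ x ∈ hfin.toFinset, (inner ℝ (gradient V (embE v)) (embE (γ x - x))
      + m * ‖embE (γ x - x)‖ ^ 2)
      ≤ ∑ x ∈ hfin.toFinset, (V (embE (γ x + v - x)) - V (embE v)) := by
    apply Finset.sum_le_sum
    intro x _
    have h := hconv (embE v) (embE (γ x + v - x))
    have e : embE (γ x + v - x) - embE v = embE (γ x - x) := by
      simp only [hadd, hadd2]
      abel
    rw [e] at h
    linarith
  rw [Finset.sum_add_distrib, hinner, zero_add, ← Finset.mul_sum] at key
  exact key
end

section
/- Let d ≥ 1, let V : ℝ^d → ℝ be differentiable, let m > 0 and v ∈ ℤ^d, and assume V(y) ≥ V(x) + ⟨∇V(x), y − x⟩ + m‖y − x‖² for all x, y ∈ ℝ^d. Then for every α > 0, β_v(V,α) ≤ β(‖·‖², mα), where β(‖·‖², mα) is defined with the Gaussian potential at temperature mα. (Consequently α*_v(V) ≤ α*(‖·‖²)/m.) -/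
open scoped ENNReal

/-- The `v`-weight `w_v(θ) = exp(−α ∑_{x ∈ supp θ} (V(θ(x)+v−x) − V(v)))`. -/
noncomputable def wv {d : ℕ} (V : EuclideanSpace ℝ (Fin d) → ℝ) (α : ℝ)
    (v : Fin d → ℤ) (θ : Equiv.Perm (Fin d → ℤ)) : ℝ :=
  Real.exp (-α * ∑ᶠ x ∈ psupp θ, (V (embE (θ x + v - x)) - V (embE v)))

/-- `β_v(V,α) = ∑_{θ finite cycle, 0 ∈ supp θ} |θ| w_v(θ)`, summed in `[0,∞]`. -/
noncomputable def betav {d : ℕ} (V : EuclideanSpace ℝ (Fin d) → ℝ) (α : ℝ)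
    (v : Fin d → ℤ) : ℝ≥0∞ :=
  ∑' θ : {θ : Equiv.Perm (Fin d → ℤ) // IsFiniteCycle θ ∧ (0 : Fin d → ℤ) ∈ psupp θ},
    ((psupp θ.1).ncard : ℝ≥0∞) * ENNReal.ofReal (wv V α v θ.1)

/-- `β(‖·‖², c)`: the Gaussian `β` at temperature `c`. -/
noncomputable def betaGauss (d : ℕ) (c : ℝ) : ℝ≥0∞ :=
  ∑' θ : {θ : Equiv.Perm (Fin d → ℤ) // IsFiniteCycle θ ∧ (0 : Fin d → ℤ) ∈ psupp θ},
    ((psupp θ.1).ncard : ℝ≥0∞) *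
      ENNReal.ofReal (Real.exp (-c * ∑ᶠ x ∈ psupp θ.1, ‖embE (θ.1 x - x)‖ ^ 2))

/-- If `V` satisfies the strong-convexity-type bound
`V(y) ≥ V(x) + ⟨∇V(x), y − x⟩ + m‖y − x‖²`, then `β_v(V,α) ≤ β(‖·‖², mα)`. -/
theorem betav_le_betaGauss (d : ℕ) (hd : 1 ≤ d)
    (V : EuclideanSpace ℝ (Fin d) → ℝ) (hdiff : Differentiable ℝ V)
    (m : ℝ) (hm : 0 < m) (v : Fin d → ℤ)
    (hconv : ∀ x y : EuclideanSpace ℝ (Fin d),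
      V x + inner ℝ (gradient V x) (y - x) + m * ‖y - x‖ ^ 2 ≤ V y)
    (α : ℝ) (hα : 0 < α) :
    betav V α v ≤ betaGauss d (m * α) := by
  unfold betav betaGauss
  refine ENNReal.tsum_le_tsum fun θ => ?_
  obtain ⟨θ, ⟨hcyc, hfin⟩, h0⟩ := θ
  have hsub : ∀ x y : Fin d → ℤ, embE (x - y) = embE x - embE y := by
    intro x y
    ext i
    simp [embE]
  have hadd : ∀ x y : Fin d → ℤ, embE (x + y) = embE x + embE y := by
    intro x y
    ext i
    simp [embE]
  dsimp only
  gcongr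
  unfold wv
  rw [finsum_mem_eq_finite_toFinset_sum _ hfin, finsum_mem_eq_finite_toFinset_sum _ hfin]
  apply Real.exp_le_exp.mpr
  have hzero : ∑ x ∈ hfin.toFinset, (embE (θ x) - embE x) = 0 := by
    rw [Finset.sum_sub_distrib, Equiv.Perm.sum_comp θ hfin.toFinset embE, sub_self]
    intro x hx
    simpa [psupp] using hx
  have hin : ∑ x ∈ hfin.toFinset,
      inner ℝ (gradient V (embE v)) (embE (θ x) - embE x) = 0 := by
    rw [← inner_sum, hzero, inner_zero_right]
  have key : m * ∑ x ∈ hfin.toFinset, ‖embE (θ x - x)‖ ^ 2 ≤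
      ∑ x ∈ hfin.toFinset, (V (embE (θ x + v - x)) - V (embE v)) := by
    have : ∑ x ∈ hfin.toFinset, (inner ℝ (gradient V (embE v)) (embE (θ x) - embE x)
        + m * ‖embE (θ x - x)‖ ^ 2) ≤
      ∑ x ∈ hfin.toFinset, (V (embE (θ x + v - x)) - V (embE v)) := by
      refine Finset.sum_le_sum fun x _ => ?_
      have h := hconv (embE v) (embE (θ x + v - x))
      have e : embE (θ x + v - x) - embE v = embE (θ x) - embE x := by
        rw [hsub, hadd]; abel
      rw [e] at h
      rw [hsub (θ x) x]
      linarith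
    rwa [Finset.sum_add_distrib, hin, zero_add, ← Finset.mul_sum] at this
  have := mul_le_mul_of_nonneg_left key hα.le
  linarith
end
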